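/- Let q = 3^m with m odd and m not divisible by 3, and let u, β be nonzero elements of GF(q). Then there is an algebraic integer z ∈ ℂ such that Σ_{x ∈ GF(q)^*} ξ₃^{Tr(β·D_7(x,u))}·χ(x) = 3^{(m−1)/2}·z, where ξ₃ = e^{2πi/3}, Tr is the trace from GF(q) to GF(3), and χ is the quadratic character of GF(q)^* (χ(x) = 1 if x is a nonzero square and χ(x) = −1 if x is a nonsquare). -/

import Mathlib

/-- The sum of the `m` ternary digits of `a` modulo `3 ^ m - 1`, computed from the cyclic
shifts `3 ^ i * a % (3 ^ m - 1)`. -/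
def cyclicDigitSum (m a : ℕ) : ℕ :=
  ∑ i ∈ Finset.range m, 3 * (3 ^ i * a % (3 ^ m - 1)) / (3 ^ m - 1)

theorem three_mul_mod_eq (N i a : ℕ) :
    3 * (3 ^ i * a % N) = N * (3 * (3 ^ i * a % N) / N) + 3 ^ (i + 1) * a % N := by
  have h : 3 ^ (i + 1) * a % N = 3 * (3 ^ i * a % N) % N := by
    rw [Nat.mul_mod_mod, pow_succ']
    ring_nf
  rw [h, Nat.div_add_mod]

theorem sum_range_shift {M : Type*} [AddCommMonoid M] [IsCancelAdd M] (f : ℕ → M) {m : ℕ}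
    (h : f m = f 0) :
    ∑ i ∈ Finset.range m, f (i + 1) = ∑ i ∈ Finset.range m, f i := by
  have h1 := Finset.sum_range_succ f m
  rw [Finset.sum_range_succ', h] at h1
  exact add_right_cancel h1

theorem three_pow_mul_mod (m a : ℕ) : 3 ^ m * a % (3 ^ m - 1) = a % (3 ^ m - 1) := by
  have h : 3 ^ m * a = a + (3 ^ m - 1) * a := by
    have := Nat.one_le_pow m 3 (by norm_num)
    nlinarith [Nat.sub_add_cancel this]
  rw [h, Nat.add_mul_mod_self_left]

theorem mul_cyclicDigitSum (m a : ℕ) :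
    (3 ^ m - 1) * cyclicDigitSum m a = 2 * ∑ i ∈ Finset.range m, 3 ^ i * a % (3 ^ m - 1) := by
  have h := Finset.sum_congr rfl fun i (_ : i ∈ Finset.range m) ↦
    three_mul_mod_eq (3 ^ m - 1) i a
  rw [Finset.sum_add_distrib, ← Finset.mul_sum, ← Finset.mul_sum,
    sum_range_shift (fun i ↦ 3 ^ i * a % (3 ^ m - 1)) (by simp [three_pow_mul_mod])] at h
  rw [cyclicDigitSum]
  omega

theorem cyclicDigitSum_zero (m : ℕ) : cyclicDigitSum m 0 = 0 := by
  simp [cyclicDigitSum]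

theorem cyclicDigitSum_three_mul (m a : ℕ) :
    cyclicDigitSum m (3 * a) = cyclicDigitSum m a := by
  have h := sum_range_shift (m := m) (fun i ↦ 3 * (3 ^ i * a % (3 ^ m - 1)) / (3 ^ m - 1))
    (by simp [three_pow_mul_mod])
  simpa only [cyclicDigitSum, pow_succ, mul_assoc] using h

theorem cyclicDigitSum_succ_le {m : ℕ} (hm : m ≠ 0) (a : ℕ) :
    cyclicDigitSum m (a + 1) ≤ cyclicDigitSum m a + 1 := by
  have hN : 0 < 3 ^ m - 1 := Nat.sub_pos_of_lt (Nat.one_lt_pow hm (by norm_num))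
  have h : ∑ i ∈ Finset.range m, 3 ^ i * (a + 1) % (3 ^ m - 1) ≤
      ∑ i ∈ Finset.range m, 3 ^ i * a % (3 ^ m - 1) + ∑ i ∈ Finset.range m, 3 ^ i := by
    rw [← Finset.sum_add_distrib]
    refine Finset.sum_le_sum fun i _ ↦ ?_
    rw [mul_add, mul_one, Nat.add_mod]
    exact (Nat.mod_le _ _).trans (Nat.add_le_add_left (Nat.mod_le _ _) _)
  have hg : 2 * ∑ i ∈ Finset.range m, 3 ^ i = 3 ^ m - 1 := by
    have := geom_sum_mul (3 : ℤ) m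
    zify [Nat.one_le_pow m 3 (by norm_num)]
    linarith
  refine Nat.le_of_mul_le_mul_left ?_ hN
  rw [mul_add, mul_cyclicDigitSum, mul_cyclicDigitSum]
  omega

/-- A potential on the carries of the addition `7 a + 5 b + c`, written in base three. -/
def carryPotential (k : ℕ) : ℤ :=
  if k % 2 = 0 then -1 else if k ≤ 3 then 0 else -2

theorem carryPotential_le {k l d e f : ℕ} (hk : 1 ≤ k) (hk' : k ≤ 13) (hl : 1 ≤ l) (hl' : l ≤ 13)
    (hd : d ≤ 2) (he : e ≤ 2) (hf : f ≤ 2) (h : 3 * k = 7 * d + 5 * e + f + l + 1) :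
    carryPotential l + 1 ≤ carryPotential k + (d + e + f) := by
  obtain rfl : l = 3 * k - (7 * d + 5 * e + f + 1) := by omega
  interval_cases d <;> interval_cases e <;> interval_cases f <;>
    simp only [carryPotential] <;> split_ifs <;> omega

theorem le_cyclicDigitSum_add {m : ℕ} (hm : m ≠ 0) {h a b c : ℕ} (hh : 2 * h = 3 ^ m - 1)
    (hdvd : 3 ^ m - 1 ∣ h + (7 * a + 5 * b + c)) :
    m ≤ cyclicDigitSum m a + cyclicDigitSum m b + cyclicDigitSum m c := by
  set N := 3 ^ m - 1 with hN
  have hNpos : 0 < N := Nat.sub_pos_of_lt (Nat.one_lt_pow hm (by norm_num))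
  have hcarry (i : ℕ) :
      ∃ k, N * k = h + (7 * (3 ^ i * a % N) + 5 * (3 ^ i * b % N) + 3 ^ i * c % N) := by
    obtain ⟨t, ht⟩ : 2 ∣ 3 ^ i - 1 := by
      simpa using Nat.sub_dvd_pow_sub_pow 3 1 i
    have h3 : 3 ^ i = 2 * t + 1 := by have := Nat.one_le_pow i 3 (by norm_num); omega
    suffices N ∣ h + (7 * (3 ^ i * a % N) + 5 * (3 ^ i * b % N) + 3 ^ i * c % N) from
      this.imp fun _ ↦ Eq.symm
    have hcast : ((h : ℕ) : ZMod N) + (7 * (3 ^ i * a) + 5 * (3 ^ i * b) + 3 ^ i * c) = 0 := by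
      have h1 := (ZMod.natCast_eq_zero_iff _ _).2 hdvd
      have h2 : ((2 * h : ℕ) : ZMod N) = 0 := by rw [hh]; exact ZMod.natCast_self N
      have h4 : (3 : ZMod N) ^ i = 2 * t + 1 := by
        exact_mod_cast congrArg (Nat.cast (R := ZMod N)) h3
      push_cast at h1 h2
      linear_combination (3 : ZMod N) ^ i * h1 - t * h2 - h * h4
    rw [← ZMod.natCast_eq_zero_iff]
    push_cast [ZMod.natCast_mod]
    exact hcast
  choose k hk using hcarry
  have hstep (i : ℕ) : carryPotential (k (i + 1)) + 1 ≤ carryPotential (k i) +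
      ((3 * (3 ^ i * a % N) / N : ℕ) + (3 * (3 ^ i * b % N) / N : ℕ) +
        (3 * (3 ^ i * c % N) / N : ℕ)) := by
    have hpos (i : ℕ) : 1 ≤ k i := by
      by_contra! hlt
      have := hk i
      simp only [Nat.lt_one_iff.1 hlt] at this
      omega
    have hle (i : ℕ) : k i ≤ 13 := by
      have ha := Nat.mod_lt (3 ^ i * a) hNpos
      have hb := Nat.mod_lt (3 ^ i * b) hNpos
      have hc := Nat.mod_lt (3 ^ i * c) hNpos
      have := hk i
      by_contra! hlt
      have := Nat.mul_le_mul_left N hlt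
      omega
    have hdig (a : ℕ) : 3 * (3 ^ i * a % N) / N ≤ 2 := by
      have := Nat.mod_lt (3 ^ i * a) hNpos
      exact Nat.le_of_lt_succ ((Nat.div_lt_iff_lt_mul hNpos).2 (by omega))
    refine carryPotential_le (hpos i) (hle i) (hpos _) (hle _) (hdig a) (hdig b) (hdig c) ?_
    have h1 := three_mul_mod_eq N i a
    have h2 := three_mul_mod_eq N i b
    have h3 := three_mul_mod_eq N i c
    refine Nat.eq_of_mul_eq_mul_left hNpos ?_
    linarith [hk i, hk (i + 1)]
  have hk0 : k m = k 0 := by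
    refine Nat.eq_of_mul_eq_mul_left hNpos ?_
    rw [hk, hk]
    simp only [N, three_pow_mul_mod, pow_zero, one_mul]
  have hsum := Finset.sum_le_sum fun i (_ : i ∈ Finset.range m) ↦ hstep i
  simp only [Finset.sum_add_distrib] at hsum
  rw [sum_range_shift (fun i ↦ carryPotential (k i)) (by rw [hk0])] at hsum
  simp only [cyclicDigitSum, ← hN]
  zify
  simp only [Finset.sum_const, Finset.card_range, nsmul_eq_mul, mul_one] at hsum
  push_cast at hsum
  linarith

section TeichmullerCharacters

theorem isUnit_of_map_ne_zero {R F : Type*} [Semiring R] [DivisionSemiring F] {ρ : R →+* F}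
    [IsLocalHom ρ] {x : R} (hx : ρ x ≠ 0) : IsUnit x :=
  IsUnit.of_map ρ x hx.isUnit

theorem sum_eq_sum_units {F M : Type*} [GroupWithZero F] [Fintype F] [DecidableEq F]
    [AddCommMonoid M] (f : F → M) (h0 : f 0 = 0) : ∑ x, f x = ∑ x : Fˣ, f x := by
  refine (Finset.sum_of_injOn (fun x : Fˣ ↦ (x : F)) Units.val_injective.injOn (by simp)
    (fun x _ hx ↦ ?_) fun _ _ ↦ rfl).symm
  rcases eq_or_ne x 0 with rfl | hx0
  · exact h0
  · exact (hx ⟨Units.mk0 x hx0, by simp⟩).elim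

variable {F R : Type*} [Field F] [CommRing R] {ρ : R →+* F} [IsLocalHom ρ] {T : F →* R}

theorem isUnit_section_sub_one (hT : ∀ x, ρ (T x) = x) {x : F} (hx : x ≠ 1) :
    IsUnit (T x - 1) :=
  isUnit_of_map_ne_zero (ρ := ρ) (by simpa [hT, sub_eq_zero] using hx)

variable [Fintype F]

theorem sum_units_section_pow [DecidableEq F] (hT : ∀ x, ρ (T x) = x) (k : ℕ) :
    ∑ x : Fˣ, T x ^ k = if Fintype.card F - 1 ∣ k then ((Fintype.card F - 1 : ℕ) : R) else 0 := by
  split_ifs with hk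
  · have h1 (x : Fˣ) : T x ^ k = 1 := by
      obtain ⟨c, rfl⟩ := hk
      rw [← map_pow, pow_mul, FiniteField.pow_card_sub_one_eq_one _ x.ne_zero, one_pow, map_one]
    simp [h1, Fintype.card_units]
  · obtain ⟨g, hg⟩ := IsCyclic.exists_generator (α := Fˣ)
    have hgk : (g : F) ^ k ≠ 1 := by
      intro h
      apply hk
      rw [← Fintype.card_units, ← Nat.card_eq_fintype_card,
        ← orderOf_eq_card_of_forall_mem_zpowers hg]
      exact orderOf_dvd_of_pow_eq_one (Units.ext (by simpa using h))
    have h := Fintype.sum_equiv (Equiv.mulLeft g) (fun x : Fˣ ↦ T (g * x : F) ^ k)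
      (fun x ↦ T x ^ k) (fun x ↦ by simp)
    simp only [map_mul, mul_pow, ← Finset.mul_sum] at h
    rw [← map_pow] at h
    refine (isUnit_section_sub_one hT hgk).mul_right_eq_zero.1 ?_
    rw [sub_one_mul, h, sub_self]

theorem sum_section_inv_pow (hT : ∀ x, ρ (T x) = x) (hT0 : T 0 = 0) {k : ℕ} (hk : k ≠ 0)
    (hk' : k < Fintype.card F - 1) : ∑ x : F, T x⁻¹ ^ k = 0 := by
  classical
  have h : ∑ x : F, T x⁻¹ ^ k = ∑ x : F, T x ^ k :=
    Fintype.sum_equiv (Equiv.inv F) _ _ fun x ↦ rfl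
  rw [h, sum_eq_sum_units _ (by simp [hT0, hk]), sum_units_section_pow hT,
    if_neg (Nat.not_dvd_of_pos_of_lt (Nat.pos_of_ne_zero hk) hk')]

/-- The Jacobi sum of the characters `T⁻ᵃ` and `T⁻¹` reduces to `-(a + 1)`. -/
theorem map_sum_section_inv_pow_mul {ρ : R →+* F} (hT : ∀ x, ρ (T x) = x) {a : ℕ} (ha : a ≠ 0)
    (ha' : a + 1 < Fintype.card F - 1) :
    ρ (∑ z : F, T z⁻¹ ^ a * T (1 - z)⁻¹) = -(a + 1 : ℕ) := by
  classical
  simp only [map_sum, map_mul, map_pow, hT]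
  have hpt (z : F) : z ^ a * (1 - z⁻¹)⁻¹ =
      ∑ i ∈ Finset.range (a + 1), z ^ i + (z - 1)⁻¹ - if z = 1 then ((a + 1 : ℕ) : F) else 0 := by
    rcases eq_or_ne z 1 with rfl | hz
    · simp
    · have hz' : z - 1 ≠ 0 := sub_ne_zero.2 hz
      have hgeom := geom_sum_mul z (a + 1)
      rw [if_neg hz, sub_zero, ← mul_left_inj' hz', add_mul, hgeom, inv_mul_cancel₀ hz']
      rcases eq_or_ne z 0 with rfl | hz0
      · simp [ha]
      · have : (1 - z⁻¹) = (z - 1) * z⁻¹ := by field_simp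
        rw [this]
        field_simp
        ring
  calc ∑ z : F, z⁻¹ ^ a * (1 - z)⁻¹ = ∑ z : F, z ^ a * (1 - z⁻¹)⁻¹ :=
        Fintype.sum_equiv (Equiv.inv F) _ _ fun x ↦ by simp
    _ = -(a + 1 : ℕ) := by
        have hinv : ∑ z : F, (z - 1)⁻¹ = 0 := by
          rw [← FiniteField.sum_pow_lt_card_sub_one F 1 (by omega)]
          exact Fintype.sum_equiv ((Equiv.subRight (1 : F)).trans (Equiv.inv F)) _ _
            fun x ↦ by simp
        simp only [hpt, Finset.sum_sub_distrib, Finset.sum_add_distrib, hinv]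
        rw [Finset.sum_comm, Finset.sum_eq_zero fun i hi ↦
          FiniteField.sum_pow_lt_card_sub_one F i (by have := Finset.mem_range.1 hi; omega)]
        simp

theorem gauss_sum_mul_gauss_sum (hT : ∀ x, ρ (T x) = x) (hT0 : T 0 = 0) (ψ : AddChar F R) {a : ℕ}
    (ha : a + 1 < Fintype.card F - 1) :
    (∑ x, T x⁻¹ ^ a * ψ x) * ∑ x, T x⁻¹ * ψ x =
      (∑ z : F, T z⁻¹ ^ a * T (1 - z)⁻¹) * ∑ x, T x⁻¹ ^ (a + 1) * ψ x := by
  have hin (s : F) : ∑ x, T x⁻¹ ^ a * T (s - x)⁻¹ =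
      (∑ z : F, T z⁻¹ ^ a * T (1 - z)⁻¹) * T s⁻¹ ^ (a + 1) := by
    rcases eq_or_ne s 0 with rfl | hs
    · have h (x : F) : T x⁻¹ ^ a * T (0 - x)⁻¹ = T (-1) * T x⁻¹ ^ (a + 1) := by
        rw [pow_succ, mul_left_comm, ← map_mul]
        congr 2
        rw [zero_sub, inv_neg, neg_one_mul]
      rw [Finset.sum_congr rfl fun x _ ↦ h x]
      simp [← Finset.mul_sum, sum_section_inv_pow hT hT0 (Nat.succ_ne_zero a) ha, hT0]
    · rw [Finset.sum_mul]
      refine (Fintype.sum_equiv (Equiv.mulLeft₀ s hs) _ _ fun z ↦ ?_).symm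
      have : s - s * z = s * (1 - z) := by ring
      simp only [Equiv.mulLeft₀_apply, this, mul_inv, map_mul, mul_pow, pow_succ]
      ring
  calc _ = ∑ x, ∑ y, T x⁻¹ ^ a * ψ x * (T y⁻¹ * ψ y) := Finset.sum_mul_sum ..
    _ = ∑ x, ∑ s, T x⁻¹ ^ a * T (s - x)⁻¹ * ψ s := by
        refine Finset.sum_congr rfl fun x _ ↦ ?_
        refine Fintype.sum_equiv (Equiv.addLeft x) _ _ fun y ↦ ?_
        simp only [Equiv.coe_addLeft, add_sub_cancel_left, AddChar.map_add_eq_mul]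
        ring
    _ = _ := by
        rw [Finset.sum_comm, Finset.mul_sum]
        refine Finset.sum_congr rfl fun s _ ↦ ?_
        rw [← Finset.sum_mul, hin]
        ring

variable {π : R} {m : ℕ}

/-- The lower bound in Stickelberger's theorem for the Gauss sums of a field of order `3 ^ m`. -/
theorem pow_cyclicDigitSum_dvd_gauss_sum [CharP F 3] (hT : ∀ x, ρ (T x) = x) (hT0 : T 0 = 0)
    {ψ : AddChar F R} (hψ : ∀ x, π ∣ ψ x - 1) (hfrob : ∀ x, ψ (x ^ 3) = ψ x)
    (hcard : Fintype.card F = 3 ^ m) (hm : m ≠ 0) (j : ℕ) (hj : j ≠ 0) (hj' : j < 3 ^ m - 1) :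
    π ^ cyclicDigitSum m j ∣ ∑ x, T x⁻¹ ^ j * ψ x := by
  have hone : π ∣ ∑ x, T x⁻¹ * ψ x := by
    have h0 : ∑ x, T x⁻¹ = 0 := by
      have : 3 ≤ 3 ^ m := Nat.le_self_pow hm 3
      simpa using sum_section_inv_pow (k := 1) hT hT0 one_ne_zero (by omega)
    have : ∑ x, T x⁻¹ * ψ x = ∑ x, T x⁻¹ * (ψ x - 1) := by
      simp [mul_sub, Finset.sum_sub_distrib, h0]
    rw [this]
    exact Finset.dvd_sum fun x _ ↦ (hψ x).mul_left _
  induction j using Nat.strong_induction_on with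
  | _ j ih =>
  by_cases h3 : 3 ∣ j
  · obtain ⟨k, rfl⟩ := h3
    rw [cyclicDigitSum_three_mul]
    have : ∑ x, T x⁻¹ ^ (3 * k) * ψ x = ∑ x, T x⁻¹ ^ k * ψ x := by
      refine Fintype.sum_equiv (frobeniusEquiv F 3).toEquiv _ _ fun x ↦ ?_
      simp [frobenius_def, hfrob, pow_mul, ← inv_pow, ← map_pow]
    rw [this]
    exact ih k (by omega) (by omega) (by omega)
  obtain ⟨a, rfl⟩ := Nat.exists_eq_succ_of_ne_zero hj
  refine (pow_dvd_pow π (cyclicDigitSum_succ_le hm a)).trans ?_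
  rw [pow_succ]
  rcases eq_or_ne a 0 with rfl | ha
  · simpa [cyclicDigitSum_zero] using hone
  · have hJ : IsUnit (∑ z : F, T z⁻¹ ^ a * T (1 - z)⁻¹) := by
      refine isUnit_of_map_ne_zero (ρ := ρ) ?_
      rw [map_sum_section_inv_pow_mul hT ha (by omega), neg_ne_zero, Ne,
        CharP.cast_eq_zero_iff F 3]
      exact h3
    rw [Nat.succ_eq_add_one, ← hJ.dvd_mul_left,
      ← gauss_sum_mul_gauss_sum hT hT0 ψ (by omega)]
    exact mul_dvd_mul (ih a (by omega) ha (by omega)) hone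

theorem exists_addChar_mul_eq_sum [CharP F 3] (hT : ∀ x, ρ (T x) = x) (hT0 : T 0 = 0)
    {ψ : AddChar F R} (hψ : ∀ x, π ∣ ψ x - 1) (hfrob : ∀ x, ψ (x ^ 3) = ψ x)
    (hcard : Fintype.card F = 3 ^ m) (hm : m ≠ 0) (y : F) :
    ∃ c : ℕ → R, (∀ j < 3 ^ m - 1, π ^ cyclicDigitSum m j ∣ c j) ∧
      ∀ x : Fˣ, ψ (y * x) = ∑ j ∈ Finset.range (3 ^ m - 1), c j * T x ^ j := by
  classical
  have h3 : 3 ≤ 3 ^ m := Nat.le_self_pow hm 3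
  rcases eq_or_ne y 0 with rfl | hy
  · refine ⟨fun j ↦ if j = 0 then 1 else 0, fun j _ ↦ ?_, fun x ↦ ?_⟩
    · rcases eq_or_ne j 0 with rfl | hj <;> simp [cyclicDigitSum_zero, *]
    · simp [ite_mul]
      omega
  obtain ⟨n, hn⟩ : IsUnit ((3 ^ m - 1 : ℕ) : R) := by
    refine isUnit_of_map_ne_zero (ρ := ρ) ?_
    rw [map_natCast, Ne, CharP.cast_eq_zero_iff F 3]
    have := dvd_pow_self 3 hm
    omega
  refine ⟨fun j ↦ (n⁻¹ : Rˣ) * (∑ z : Fˣ, T (z : F)⁻¹ ^ j * ψ z) * T y ^ j,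
    fun j hj ↦ ?_, fun x ↦ ?_⟩
  · rcases eq_or_ne j 0 with rfl | hj0
    · simp [cyclicDigitSum_zero]
    · refine ((Units.dvd_mul_left).2 ?_).mul_right _
      have := pow_cyclicDigitSum_dvd_gauss_sum hT hT0 hψ hfrob hcard hm j hj0 hj
      rwa [sum_eq_sum_units _ (by simp [hT0, hj0])] at this
  · have hin (z : Fˣ) : ∑ j ∈ Finset.range (3 ^ m - 1), T ((z : F)⁻¹ * (y * x)) ^ j =
        if z = Units.mk0 y hy * x then (n : R) else 0 := by
      split_ifs with hz
      · have : (z : F)⁻¹ * (y * x) = 1 := by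
          rw [hz, Units.val_mul, Units.val_mk0, inv_mul_cancel₀ (by simp [hy])]
        simp [this, hn]
      · have hne : (z : F)⁻¹ * (y * x) ≠ 1 := by
          intro h
          apply hz
          ext
          rw [inv_mul_eq_one₀ z.ne_zero] at h
          simp [h]
        have h0 : (z : F)⁻¹ * (y * x) ≠ 0 := by simp [hy]
        refine (isUnit_section_sub_one hT hne).mul_left_eq_zero.1 ?_
        rw [geom_sum_mul, ← map_pow, ← hcard, FiniteField.pow_card_sub_one_eq_one _ h0, map_one,
          sub_self]
    have hsum : n * ψ (y * x) =
        ∑ j ∈ Finset.range (3 ^ m - 1), (∑ z : Fˣ, T (z : F)⁻¹ ^ j * ψ z) * T y ^ j * T x ^ j := by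
      simp only [Finset.sum_mul]
      rw [Finset.sum_comm]
      calc n * ψ (y * x) = ∑ z : Fˣ, (if z = Units.mk0 y hy * x then (n : R) else 0) * ψ z := by
            simp [ite_mul]
        _ = _ := by
            refine Finset.sum_congr rfl fun z _ ↦ ?_
            rw [← hin, Finset.sum_mul]
            refine Finset.sum_congr rfl fun j _ ↦ ?_
            simp only [map_mul, mul_pow]
            ring
    rw [← n.inv_mul_cancel_left (ψ (y * x)), hsum, Finset.mul_sum]
    exact Finset.sum_congr rfl fun j _ ↦ by ring

theorem pow_dvd_sum_section_mul_addChar [DecidableEq F] [CharP F 3] (hT : ∀ x, ρ (T x) = x)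
    (hT0 : T 0 = 0) {ψ : AddChar F R} (hψ : ∀ x, π ∣ ψ x - 1) (hfrob : ∀ x, ψ (x ^ 3) = ψ x)
    (hcard : Fintype.card F = 3 ^ m) (hm : m ≠ 0) {h : ℕ} (hh : 2 * h = 3 ^ m - 1)
    (y₇ y₅ y₁ : F) :
    π ^ m ∣ ∑ x : Fˣ, T x ^ h * ψ (y₇ * x ^ 7 + y₅ * x ^ 5 + y₁ * x) := by
  obtain ⟨a, ha, ha'⟩ := exists_addChar_mul_eq_sum hT hT0 hψ hfrob hcard hm y₇
  obtain ⟨b, hb, hb'⟩ := exists_addChar_mul_eq_sum hT hT0 hψ hfrob hcard hm y₅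
  obtain ⟨c, hc, hc'⟩ := exists_addChar_mul_eq_sum hT hT0 hψ hfrob hcard hm y₁
  set N := 3 ^ m - 1 with hN
  have hexp : ∑ x : Fˣ, T x ^ h * ψ (y₇ * x ^ 7 + y₅ * x ^ 5 + y₁ * x) =
      ∑ k ∈ Finset.range N, ∑ j ∈ Finset.range N, ∑ i ∈ Finset.range N,
        a i * b j * c k * ∑ x : Fˣ, T x ^ (h + (7 * i + 5 * j + k)) := by
    have h7 (x : Fˣ) := ha' (x ^ 7)
    have h5 (x : Fˣ) := hb' (x ^ 5)
    simp only [Units.val_pow_eq_pow_val] at h7 h5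
    simp only [AddChar.map_add_eq_mul, h7, h5, hc', Finset.mul_sum,
      Finset.sum_mul]
    rw [Finset.sum_comm]
    refine Finset.sum_congr rfl fun k _ ↦ ?_
    rw [Finset.sum_comm]
    refine Finset.sum_congr rfl fun j _ ↦ ?_
    rw [Finset.sum_comm]
    refine Finset.sum_congr rfl fun i _ ↦ Finset.sum_congr rfl fun x _ ↦ ?_
    simp only [map_pow]
    ring
  rw [hexp]
  refine Finset.dvd_sum fun k hk ↦ Finset.dvd_sum fun j hj ↦ Finset.dvd_sum fun i hi ↦ ?_
  rw [sum_units_section_pow hT, hcard, ← hN]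
  split_ifs with hdvd
  · refine Dvd.dvd.mul_right ((pow_dvd_pow π (le_cyclicDigitSum_add hm hh hdvd)).trans ?_) _
    rw [pow_add, pow_add]
    exact mul_dvd_mul (mul_dvd_mul (ha i (Finset.mem_range.1 hi)) (hb j (Finset.mem_range.1 hj)))
      (hc k (Finset.mem_range.1 hk))
  · simp

theorem section_pow_eq_ite [DecidableEq F] [CharP F 3] (hT : ∀ x, ρ (T x) = x) (x : Fˣ) :
    T x ^ (Fintype.card F / 2) = if IsSquare (x : F) then 1 else -1 := by
  have hF : ringChar F ≠ 2 := by
    rw [ringChar.eq F 3]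
    norm_num
  have hsq := FiniteField.isSquare_iff hF x.ne_zero
  have hneg : T (-1) = -1 := by
    have hne : (-1 : F) ≠ 1 := Ring.neg_one_ne_one_of_char_ne_two hF
    rw [← sub_eq_zero, sub_neg_eq_add]
    refine (isUnit_section_sub_one hT hne).mul_right_eq_zero.1 ?_
    have : T (-1) * T (-1) = 1 := by rw [← map_mul]; simp
    linear_combination this
  rw [← map_pow]
  split_ifs with h
  · rw [hsq.1 h, map_one]
  · rw [(FiniteField.pow_dichotomy hF x.ne_zero).resolve_left fun h' ↦ h (hsq.2 h'), hneg]

end TeichmullerCharacters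

section EisensteinWitt

open WittVector QuadraticAlgebra

theorem omega_sq (W : Type*) [CommRing W] : (ω : QuadraticAlgebra W (-1) (-1)) ^ 2 = -1 - ω := by
  ext <;> simp [sq]

theorem three_pow_dvd_omega_sub_one_pow (W : Type*) [CommRing W] {m : ℕ} (hm : Odd m) :
    (3 : QuadraticAlgebra W (-1) (-1)) ^ ((m - 1) / 2) ∣ (ω - 1) ^ m := by
  obtain ⟨k, rfl⟩ := hm
  have h : ((ω : QuadraticAlgebra W (-1) (-1)) - 1) ^ 2 = 3 * -ω := by
    linear_combination omega_sq W
  rw [pow_succ, pow_mul, h, mul_pow, show (2 * k + 1 - 1) / 2 = k by omega, mul_assoc]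
  exact dvd_mul_right _ _

theorem three_pow_dvd_of_intCast {W F : Type*} [CommRing W] [IsDomain W] [Ring F] [CharP F 3]
    (ρ : W →+* F) (h3 : (3 : W) ≠ 0) (k : ℕ) (n : ℤ) (h : (3 : W) ^ k ∣ n) : (3 : ℤ) ^ k ∣ n := by
  induction k generalizing n with
  | zero => simp
  | succ k ih =>
    have hF : ((3 : ℕ) : F) = 0 := CharP.cast_eq_zero F 3
    obtain ⟨l, rfl⟩ : (3 : ℤ) ∣ n := by
      have h0 : (n : F) = 0 := by
        obtain ⟨w, hw⟩ := (Dvd.intro_left _ (pow_succ (3 : W) k).symm).trans h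
        have := congrArg ρ hw
        rw [map_mul, map_intCast, ← Nat.cast_ofNat, map_natCast, hF, zero_mul] at this
        exact this
      exact_mod_cast (CharP.intCast_eq_zero_iff F 3 n).1 h0
    rw [pow_succ']
    refine mul_dvd_mul_left 3 (ih l ?_)
    push_cast at h
    rw [pow_succ'] at h
    exact (mul_dvd_mul_iff_left h3).1 h

variable (F : Type*) [Field F] [CharP F 3]

/-- Reduction of `W(F)[ω]`, where `ω ^ 2 + ω + 1 = 0`, modulo its maximal ideal. -/
noncomputable def eisensteinWittResidue : QuadraticAlgebra (WittVector 3 F) (-1) (-1) →+* F where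
  toFun z := constantCoeff z.re + constantCoeff z.im
  map_zero' := by simp
  map_one' := by simp
  map_add' x y := by
    rw [re_add, im_add, map_add, map_add]
    ring
  map_mul' x y := by
    have h3 : (3 : F) = 0 := CharP.cast_eq_zero F 3
    simp only [re_mul, im_mul, map_add, map_mul, map_neg, map_one]
    linear_combination (-constantCoeff x.im * constantCoeff y.im) * h3

instance : IsLocalHom (eisensteinWittResidue F) where
  map_nonunit z hz := by
    rw [isUnit_iff_norm_isUnit]
    refine isUnit_of_coeff_zero_ne_zero _ ?_
    rw [← constantCoeff_apply]
    have h3 : (3 : F) = 0 := CharP.cast_eq_zero F 3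
    have : constantCoeff (QuadraticAlgebra.norm z) = eisensteinWittResidue F z ^ 2 := by
      simp only [QuadraticAlgebra.norm_def, eisensteinWittResidue, RingHom.coe_mk, MonoidHom.coe_mk,
        OneHom.coe_mk, map_add, map_sub, map_mul, map_neg, map_one]
      linear_combination (-constantCoeff z.re * constantCoeff z.im) * h3
    rw [this]
    exact pow_ne_zero 2 hz.ne_zero

variable {F} [Fintype F] [Algebra (ZMod 3) F]

theorem trace_pow_three (x : F) :
    Algebra.trace (ZMod 3) F (x ^ 3) = Algebra.trace (ZMod 3) F x := by
  have := Algebra.trace_eq_of_algEquiv (FiniteField.frobeniusAlgEquiv (ZMod 3) F 3) x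
  simpa using this

theorem three_pow_dvd_character_sum [DecidableEq F] {m : ℕ} (hm : Odd m) (hcard : Fintype.card F = 3 ^ m)
    (u β : F) :
    (3 : QuadraticAlgebra (WittVector 3 F) (-1) (-1)) ^ ((m - 1) / 2) ∣
      ∑ x : Fˣ, ω ^ (Algebra.trace (ZMod 3) F
        (β * (x ^ 7 - u * x ^ 5 - u ^ 2 * x ^ 3 - u ^ 3 * x))).val *
          (if IsSquare (x : F) then 1 else -1) := by
  set R := QuadraticAlgebra (WittVector 3 F) (-1) (-1)
  have hω : (ω : R) ^ 3 = 1 := by linear_combination (ω - 1 : R) * omega_sq (WittVector 3 F)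
  let T : F →* R := (algebraMap (WittVector 3 F) R).toMonoidHom.comp (teichmuller 3)
  have hT (x : F) : eisensteinWittResidue F (T x) = x := by
    simp [T, eisensteinWittResidue, teichmuller_coeff_zero, R]
  have hT0 : T 0 = 0 := by simp [T, teichmuller_zero]
  let ψ : AddChar F R :=
    (AddChar.zmodChar 3 hω).compAddMonoidHom (Algebra.trace (ZMod 3) F).toAddMonoidHom
  have hψ_apply (x : F) : ψ x = ω ^ (Algebra.trace (ZMod 3) F x).val := rfl
  have hψ (x : F) : (ω - 1 : R) ∣ ψ x - 1 := sub_one_dvd_pow_sub_one _ _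
  have hfrob (x : F) : ψ (x ^ 3) = ψ x := by rw [hψ_apply, trace_pow_three, hψ_apply]
  obtain ⟨γ, hγ⟩ : ∃ γ : F, γ ^ 3 = β * u ^ 2 := (frobeniusEquiv F 3).surjective _
  have hh : 2 * (Fintype.card F / 2) = 3 ^ m - 1 := by
    rw [hcard]
    have : 3 ^ m % 2 = 1 := Nat.odd_iff.1 (Odd.pow (by decide))
    omega
  refine (three_pow_dvd_omega_sub_one_pow _ hm).trans ?_
  convert pow_dvd_sum_section_mul_addChar hT hT0 hψ hfrob hcard hm.pos.ne' hh β (-(β * u))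
    (-(γ + β * u ^ 3)) using 1
  refine Finset.sum_congr rfl fun x _ ↦ ?_
  rw [section_pow_eq_ite hT, ← hψ_apply, mul_comm]
  congr 1
  have h1 : β * (x ^ 7 - u * x ^ 5 - u ^ 2 * x ^ 3 - u ^ 3 * x) =
      β * x ^ 7 + -(β * u) * x ^ 5 - β * u ^ 3 * x - (γ * x) ^ 3 := by
    rw [mul_pow, hγ]
    ring
  have h2 : β * x ^ 7 + -(β * u) * x ^ 5 + -(γ + β * u ^ 3) * x =
      β * x ^ 7 + -(β * u) * x ^ 5 - β * u ^ 3 * x - γ * x := by ring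
  have hneg : ψ (-(γ * x) ^ 3) = ψ (-(γ * x)) := by
    rw [← hfrob (-(γ * x))]
    congr 1
    ring
  rw [h1, h2, sub_eq_add_neg _ ((γ * x) ^ 3), sub_eq_add_neg _ (γ * x : F),
    AddChar.map_add_eq_mul, AddChar.map_add_eq_mul, hneg]

end EisensteinWitt

theorem sum_pow_val_mul_eq {A ι : Type*} [CommRing A] {ζ : A} (hζ : ζ ^ 2 = -1 - ζ) (s : Finset ι)
    (t : ι → ZMod 3) (p : ι → Prop) [DecidablePred p] :
    ∑ i ∈ s, ζ ^ (t i).val * (if p i then 1 else -1) =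
      ((∑ i ∈ s, (![1, 0, -1] : Fin 3 → ℤ) (t i) * (if p i then 1 else -1) : ℤ) : A) +
      ((∑ i ∈ s, (![0, 1, -1] : Fin 3 → ℤ) (t i) * (if p i then 1 else -1) : ℤ) : A) * ζ := by
  push_cast
  rw [Finset.sum_mul, ← Finset.sum_add_distrib]
  refine Finset.sum_congr rfl fun i _ ↦ ?_
  have h (c : ZMod 3) : ζ ^ c.val =
      ((![1, 0, -1] : Fin 3 → ℤ) c : A) + ((![0, 1, -1] : Fin 3 → ℤ) c : A) * ζ := by
    change Fin 3 at c
    fin_cases c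
    · simp [ZMod.val]
    · simp [ZMod.val]
    · simp [ZMod.val, hζ]; ring
  rw [h]
  split_ifs <;> simp; ring

/-- The character sum `S_β = Σ_{x ≠ 0} ξ₃^{Tr(β·D₇(x,u))} χ(x)` is divisible by
`3^{(m−1)/2}` in the ring of algebraic integers, where `χ` is the quadratic
character of `GF(3^m)^*` and `Tr` the trace to `GF(3)`. -/
theorem character_sum_divisible_by_power_of_three
    (m : ℕ) (hm : Odd m) (hm3 : ¬ (3 ∣ m)) (F : Type*) [Field F] [Fintype F]
    [DecidableEq F] [Algebra (ZMod 3) F] (hcard : Fintype.card F = 3 ^ m)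
    (u β : F) (hu : u ≠ 0) (hβ : β ≠ 0) :
    ∃ z : ℂ, IsIntegral ℤ z ∧
      ∑ x ∈ Finset.univ.filter (fun x : F => x ≠ 0),
        (Complex.exp (2 * Real.pi * Complex.I / 3)) ^
            ((Algebra.trace (ZMod 3) F
              (β * (x ^ 7 - u * x ^ 5 - u ^ 2 * x ^ 3 - u ^ 3 * x))).val) *
          (if IsSquare x then (1 : ℂ) else -1)
        = (3 : ℂ) ^ ((m - 1) / 2) * z := by
  have : CharP F 3 := charP_of_injective_algebraMap (algebraMap (ZMod 3) F).injective 3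
  set ζ := Complex.exp (2 * Real.pi * Complex.I / 3)
  have hprim : IsPrimitiveRoot ζ 3 := by
    simpa using Complex.isPrimitiveRoot_exp 3 (by norm_num)
  have hζ : ζ ^ 2 = -1 - ζ := by
    have := hprim.geom_sum_eq_zero (by norm_num)
    simp only [Finset.sum_range_succ, Finset.sum_range_zero, pow_zero, pow_one] at this
    linear_combination this
  have hdvd := three_pow_dvd_character_sum hm hcard u β
  rw [sum_pow_val_mul_eq (omega_sq _)] at hdvd
  have hsum : ∑ x ∈ Finset.univ.filter (fun x : F => x ≠ 0), ζ ^ ((Algebra.trace (ZMod 3) F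
        (β * (x ^ 7 - u * x ^ 5 - u ^ 2 * x ^ 3 - u ^ 3 * x))).val) *
          (if IsSquare x then (1 : ℂ) else -1) =
      ∑ x : Fˣ, ζ ^ ((Algebra.trace (ZMod 3) F
        (β * (x ^ 7 - u * x ^ 5 - u ^ 2 * x ^ 3 - u ^ 3 * x))).val) *
          (if IsSquare (x : F) then (1 : ℂ) else -1) := by
    rw [Finset.sum_filter, sum_eq_sum_units _ (by simp)]
    simp
  rw [hsum, sum_pow_val_mul_eq hζ]
  generalize (m - 1) / 2 = k at hdvd ⊢
  generalize (∑ x : Fˣ, (_ : ℤ)) = a at hdvd ⊢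
  generalize (∑ x : Fˣ, (_ : ℤ)) = b at hdvd ⊢
  have h3 : (3 : WittVector 3 F) ≠ 0 := by exact_mod_cast WittVector.p_nonzero 3 F
  have hmap : (3 : QuadraticAlgebra (WittVector 3 F) (-1) (-1)) ^ k =
      algebraMap (WittVector 3 F) _ (3 ^ k) := by
    rw [map_pow, map_ofNat]
  rw [hmap, QuadraticAlgebra.algebraMap_dvd_iff] at hdvd
  obtain ⟨c, hc⟩ : (3 : ℤ) ^ k ∣ a :=
    three_pow_dvd_of_intCast WittVector.constantCoeff h3 k a (by simpa using hdvd.1)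
  obtain ⟨d, hd⟩ : (3 : ℤ) ^ k ∣ b :=
    three_pow_dvd_of_intCast WittVector.constantCoeff h3 k b (by simpa using hdvd.2)
  refine ⟨c + d * ζ, ?_, by rw [hc, hd]; push_cast; ring⟩
  have hint : IsIntegral ℤ ζ := hprim.isIntegral (by norm_num)
  exact (isIntegral_algebraMap (x := c)).add ((isIntegral_algebraMap (x := d)).mul hint)
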